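/- Let 0 < p < q ≤ 1, and let a, b, t be nonnegative integers with 1 ≤ t ≤ a. Then the sum of independent binomials Bin(a − t, p) + Bin(b + t, q) first-order stochastically dominates Bin(a, p) + Bin(b, q); moreover, Pr(Bin(a − t, p) + Bin(b + t, q) = a + b) = p^{a−t}·q^{b+t} > p^a·q^b = Pr(Bin(a, p) + Bin(b, q) = a + b), so the distribution of Bin(a, p) + Bin(b, q) does NOT first-order stochastically dominate that of Bin(a − t, p) + Bin(b + t, q). (This is the key step in the necessity direction of the three-signal EA characterization: if signals are not uniformly self-predicting, moving reports from a lower-probability cell to a higher-probability cell yields a deviation not dominated by truth-telling.) -/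

import Mathlib

/-- The probability mass function of the binomial distribution `Bin(n, p)`. -/
noncomputable def binomPMF (n : ℕ) (p : ℝ) : ℕ → ℝ :=
  fun k => (n.choose k : ℝ) * p ^ k * (1 - p) ^ (n - k)

/-- Convolution of two mass functions on `ℕ` (the mass function of the sum of two
independent `ℕ`-valued random variables). -/
noncomputable def nconv (f g : ℕ → ℝ) : ℕ → ℝ :=
  fun k => ∑ i ∈ Finset.range (k + 1), f i * g (k - i)

/-- First-order stochastic dominance of `f` over `g`, for mass functions on `ℕ`:
`Pr_f(X ≥ t) ≥ Pr_g(Y ≥ t)` for every real threshold `t`. -/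
def FOSD (f g : ℕ → ℝ) : Prop :=
  ∀ t : ℝ, ∑' k : ℕ, (if t ≤ (k : ℝ) then g k else 0) ≤
    ∑' k : ℕ, (if t ≤ (k : ℝ) then f k else 0)

open Polynomial in
/-- The probability generating polynomial of a Bernoulli variable with parameter `p`. -/
noncomputable def bernoulliPoly (p : ℝ) : ℝ[X] := C p * X + C (1 - p)

open Polynomial in
theorem natDegree_bernoulliPoly_le (p : ℝ) : (bernoulliPoly p).natDegree ≤ 1 :=
  natDegree_linear_le

open Polynomial in
theorem coeff_bernoulliPoly_pow (n : ℕ) (p : ℝ) (k : ℕ) :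
    (bernoulliPoly p ^ n).coeff k = binomPMF n p k := by
  have h (i : ℕ) : (C p * X) ^ i * C (1 - p) ^ (n - i) * ((n.choose i : ℕ) : ℝ[X])
      = C ((n.choose i : ℝ) * p ^ i * (1 - p) ^ (n - i)) * X ^ i := by
    simp only [C_mul, C_pow, mul_pow, C_eq_natCast]
    ring
  simp only [bernoulliPoly, binomPMF, add_pow, h, finsetSum_coeff, coeff_C_mul_X_pow]
  rw [Finset.sum_ite_eq, ite_eq_left_iff]
  intro hk
  rw [Nat.choose_eq_zero_of_lt (by simpa [Nat.lt_succ_iff] using hk)]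
  simp

open Polynomial in
theorem nconv_binomPMF_eq_coeff (a b : ℕ) (p q : ℝ) :
    nconv (binomPMF a p) (binomPMF b q) =
      fun k => (bernoulliPoly p ^ a * bernoulliPoly q ^ b).coeff k := by
  funext k
  simp only [nconv, coeff_mul, coeff_bernoulliPoly_pow]
  rw [Finset.Nat.sum_antidiagonal_eq_sum_range_succ (fun i j => binomPMF a p i * binomPMF b q j)]

open Polynomial in
theorem natDegree_bernoulliPoly_pow_le (p : ℝ) (n : ℕ) :
    (bernoulliPoly p ^ n).natDegree ≤ n := by
  simpa using natDegree_pow_le_of_le n (natDegree_bernoulliPoly_le p)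

open Polynomial in
theorem natDegree_bernoulliPoly_pow_mul_pow_le (p q : ℝ) (a b : ℕ) :
    (bernoulliPoly p ^ a * bernoulliPoly q ^ b).natDegree ≤ a + b :=
  natDegree_mul_le_of_le (natDegree_bernoulliPoly_pow_le p a) (natDegree_bernoulliPoly_pow_le q b)

theorem nconv_binomPMF_top (a b : ℕ) (p q : ℝ) :
    nconv (binomPMF a p) (binomPMF b q) (a + b) = p ^ a * q ^ b := by
  rw [nconv_binomPMF_eq_coeff]
  simp only
  rw [Polynomial.coeff_mul_add_eq_of_natDegree_le (natDegree_bernoulliPoly_pow_le p a)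
    (natDegree_bernoulliPoly_pow_le q b)]
  simp [coeff_bernoulliPoly_pow, binomPMF]

theorem nconv_binomPMF_eq_zero_of_lt {a b k : ℕ} (p q : ℝ) (hk : a + b < k) :
    nconv (binomPMF a p) (binomPMF b q) k = 0 := by
  rw [nconv_binomPMF_eq_coeff]
  exact Polynomial.coeff_eq_zero_of_natDegree_lt
    ((natDegree_bernoulliPoly_pow_mul_pow_le p q a b).trans_lt hk)

theorem tsum_tail_nconv_binomPMF_top (a b : ℕ) (p q : ℝ) :
    ∑' k : ℕ, (if ((a + b : ℕ) : ℝ) ≤ (k : ℝ) then nconv (binomPMF a p) (binomPMF b q) k else 0)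
      = p ^ a * q ^ b := by
  rw [tsum_eq_single (a + b), if_pos le_rfl, nconv_binomPMF_top]
  intro k hk
  split_ifs with h
  · exact nconv_binomPMF_eq_zero_of_lt p q (lt_of_le_of_ne (by exact_mod_cast h) hk.symm)
  · rfl

theorem coeff_mul_nonneg {P Q : Polynomial ℝ} (hP : ∀ k, 0 ≤ P.coeff k)
    (hQ : ∀ k, 0 ≤ Q.coeff k) (k : ℕ) : 0 ≤ (P * Q).coeff k := by
  rw [Polynomial.coeff_mul]
  exact Finset.sum_nonneg fun i _ => mul_nonneg (hP _) (hQ _)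

theorem coeff_bernoulliPoly_pow_nonneg {p : ℝ} (hp : 0 ≤ p) (hp1 : p ≤ 1) (n k : ℕ) :
    0 ≤ (bernoulliPoly p ^ n).coeff k := by
  have := sub_nonneg.2 hp1
  rw [coeff_bernoulliPoly_pow, binomPMF]
  positivity

open Polynomial in
theorem sum_tail_coeff_X_sub_one_mul_nonneg {S : ℝ[X]} (hS : ∀ k, 0 ≤ S.coeff k) (s : ℝ)
    (N : ℕ) : 0 ≤ ∑ k ∈ Finset.range (N + 1),
      (if s ≤ (k : ℝ) then ((X - 1) * S).coeff k else 0) + S.coeff N := by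
  induction N with
  | zero =>
    by_cases h : s ≤ 0 <;> simp [h, hS, sub_mul]
  | succ N ih =>
    rw [Finset.sum_range_succ]
    by_cases h : s ≤ ((N + 1 : ℕ) : ℝ)
    · have hc : ((X - 1) * S).coeff (N + 1) = S.coeff N - S.coeff (N + 1) := by
        rw [sub_mul, coeff_sub, coeff_X_mul, one_mul]
      rw [if_pos h, hc]
      linarith
    · rw [if_neg h, Finset.sum_eq_zero]
      · simpa using hS (N + 1)
      · intro k hk
        have hk' : (k : ℝ) ≤ ((N + 1 : ℕ) : ℝ) := by
          exact_mod_cast (Finset.mem_range.1 hk).le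
        exact if_neg fun h' => h (h'.trans hk')

open Polynomial in
/-- If two finitely supported mass functions have generating polynomials differing by
`(X - 1) * S` with `S` having nonnegative coefficients, then one dominates the other. -/
theorem FOSD_coeff_of_sub_eq {P Q S : ℝ[X]} (hS : ∀ k, 0 ≤ S.coeff k)
    (h : Q - P = (X - 1) * S) : FOSD (fun k => Q.coeff k) (fun k => P.coeff k) := by
  intro s
  set N := max (max P.natDegree Q.natDegree) S.natDegree + 1 with hN
  have tail (R : ℝ[X]) (hR : R.natDegree < N) :
      ∑' k : ℕ, (if s ≤ (k : ℝ) then R.coeff k else 0)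
        = ∑ k ∈ Finset.range (N + 1), (if s ≤ (k : ℝ) then R.coeff k else 0) := by
    refine tsum_eq_sum fun k hk => ?_
    rw [coeff_eq_zero_of_natDegree_lt (by simp at hk; omega), ite_self]
  rw [tail P (by omega), tail Q (by omega), ← sub_nonneg, ← Finset.sum_sub_distrib]
  have key := sum_tail_coeff_X_sub_one_mul_nonneg hS s N
  rw [coeff_eq_zero_of_natDegree_lt (by omega : S.natDegree < N), add_zero, ← h] at key
  refine key.trans_eq (Finset.sum_congr rfl fun k _ => ?_)
  split_ifs <;> simp

open Polynomial in
theorem FOSD_nconv_binomPMF_shift {p q : ℝ} (hp : 0 ≤ p) (hpq : p ≤ q) (hq : q ≤ 1)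
    (a b t : ℕ) :
    FOSD (nconv (binomPMF a p) (binomPMF (b + t) q))
      (nconv (binomPMF (a + t) p) (binomPMF b q)) := by
  simp only [nconv_binomPMF_eq_coeff]
  have hBp := coeff_bernoulliPoly_pow_nonneg hp (hpq.trans hq)
  have hBq := coeff_bernoulliPoly_pow_nonneg (hp.trans hpq) hq
  refine FOSD_coeff_of_sub_eq
    (S := C (q - p) * (bernoulliPoly p ^ a * bernoulliPoly q ^ b *
      ∑ i ∈ Finset.range t, bernoulliPoly q ^ i * bernoulliPoly p ^ (t - 1 - i))) ?_ ?_
  · intro k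
    rw [coeff_C_mul]
    refine mul_nonneg (sub_nonneg.2 hpq)
      (coeff_mul_nonneg (coeff_mul_nonneg (hBp a) (hBq b)) (fun j => ?_) k)
    rw [finsetSum_coeff]
    exact Finset.sum_nonneg fun i _ => coeff_mul_nonneg (hBq i) (hBp _) j
  · have hsub : bernoulliPoly q - bernoulliPoly p = (X - 1) * C (q - p) := by
      simp only [bernoulliPoly, C_sub, C_1]
      ring
    have hgeom := geom_sum₂_mul (bernoulliPoly q) (bernoulliPoly p) t
    rw [hsub] at hgeom
    rw [pow_add, pow_add]
    linear_combination (-(bernoulliPoly p ^ a * bernoulliPoly q ^ b)) * hgeom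

/-- Key step in the necessity direction of the three-signal EA characterization:
for `0 < p < q ≤ 1` and `1 ≤ t ≤ a`, the sum `Bin(a − t, p) + Bin(b + t, q)`
FOSD-dominates `Bin(a, p) + Bin(b, q)`; moreover the top atom satisfies
`Pr(Bin(a − t, p) + Bin(b + t, q) = a + b) = p^{a−t} q^{b+t} > p^a q^b
 = Pr(Bin(a, p) + Bin(b, q) = a + b)`, so `Bin(a, p) + Bin(b, q)` does NOT
FOSD-dominate `Bin(a − t, p) + Bin(b + t, q)`. -/
theorem ea_necessity_key_step
    (p q : ℝ) (hp : 0 < p) (hpq : p < q) (hq : q ≤ 1)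
    (a b t : ℕ) (ht1 : 1 ≤ t) (hta : t ≤ a) :
    FOSD (nconv (binomPMF (a - t) p) (binomPMF (b + t) q))
         (nconv (binomPMF a p) (binomPMF b q)) ∧
    nconv (binomPMF (a - t) p) (binomPMF (b + t) q) (a + b)
      = p ^ (a - t) * q ^ (b + t) ∧
    nconv (binomPMF a p) (binomPMF b q) (a + b) = p ^ a * q ^ b ∧
    p ^ a * q ^ b < p ^ (a - t) * q ^ (b + t) ∧
    ¬ FOSD (nconv (binomPMF a p) (binomPMF b q))
           (nconv (binomPMF (a - t) p) (binomPMF (b + t) q)) := by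
  have hq0 : 0 < q := hp.trans hpq
  obtain ⟨c, rfl⟩ := Nat.exists_eq_add_of_le' hta
  rw [Nat.add_sub_cancel, show c + t + b = c + (b + t) by omega]
  have htop : nconv (binomPMF (c + t) p) (binomPMF b q) (c + (b + t)) = p ^ (c + t) * q ^ b := by
    rw [← nconv_binomPMF_top, show c + (b + t) = c + t + b by omega]
  have hlt : p ^ (c + t) * q ^ b < p ^ c * q ^ (b + t) := by
    have h : p ^ t < q ^ t := pow_lt_pow_left₀ hpq hp.le (by omega)
    calc p ^ (c + t) * q ^ b = p ^ c * q ^ b * p ^ t := by ring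
      _ < p ^ c * q ^ b * q ^ t := by gcongr
      _ = p ^ c * q ^ (b + t) := by ring
  refine ⟨FOSD_nconv_binomPMF_shift hp.le hpq.le hq c b t, nconv_binomPMF_top _ _ _ _, htop, hlt,
    fun hdom => ?_⟩
  have h := hdom ((c + (b + t) : ℕ) : ℝ)
  rw [tsum_tail_nconv_binomPMF_top, show c + (b + t) = c + t + b by omega,
    tsum_tail_nconv_binomPMF_top] at h
  exact hlt.not_ge h
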